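/- Let ρ ∈ (0, 1/2) and θ ∈ (0, 1/2) satisfy H_b(ρ) + H_b(θ) > 1. Then there exists a unique δ ∈ (0, ρ) such that H_b(δ*θ) − H_b(δ) = 1 − H_b(ρ). -/

import Mathlib

/-- Binary convolution: `p*q := (1−p)q + p(1−q)`. -/
def bconv (p q : ℝ) : ℝ := (1 - p) * q + p * (1 - q)

/-- The base-2 binary entropy function (with the convention `H_b(0) = H_b(1) = 0`,
which holds automatically since `Real.logb 2 0 = 0`). -/
noncomputable def binEnt (p : ℝ) : ℝ := -p * Real.logb 2 p - (1 - p) * Real.logb 2 (1 - p)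

theorem binEnt_eq (p : ℝ) : binEnt p = Real.binEntropy p / Real.log 2 := by
  simp only [binEnt, Real.logb, Real.binEntropy, Real.log_inv]
  ring

theorem gap_strictAnti (θ : ℝ) (h0 : 0 < θ) (h1 : θ < 1/2) :
    StrictAntiOn (fun δ => Real.binEntropy (bconv δ θ) - Real.binEntropy δ)
      (Set.Icc 0 (1/2)) := by
  apply strictAntiOn_of_deriv_neg (convex_Icc _ _)
  · apply Continuous.continuousOn
    unfold bconv
    fun_prop
  · intro x hx
    rw [interior_Icc] at hx
    obtain ⟨hx0, hx1⟩ := hx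
    have hc1 : x < bconv x θ := by unfold bconv; nlinarith
    have hc2 : bconv x θ < 1/2 := by unfold bconv; nlinarith
    have hb : HasDerivAt (fun δ => bconv δ θ) (1 - 2 * θ) x := by
      have := (((hasDerivAt_id x).const_sub 1).mul_const θ).add
        ((hasDerivAt_id x).mul_const (1 - θ))
      exact HasDerivAt.congr_deriv this (by ring)
    have hd1 := (Real.hasDerivAt_binEntropy (p := bconv x θ)
      (by linarith) (by linarith)).comp x hb
    have hd2 := Real.hasDerivAt_binEntropy (p := x) (by linarith) (by linarith)
    have hd := (hd1.sub hd2).deriv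
    have e : deriv (fun δ => Real.binEntropy (bconv δ θ) - Real.binEntropy δ) x = _ := hd
    rw [e]
    have l1 : Real.log x < Real.log (bconv x θ) := Real.log_lt_log hx0 hc1
    have l2 : Real.log (1 - bconv x θ) < Real.log (1 - x) :=
      Real.log_lt_log (by linarith) (by linarith)
    have l3 : Real.log (bconv x θ) < Real.log (1 - bconv x θ) :=
      Real.log_lt_log (by linarith) (by linarith)
    nlinarith [mul_pos h0 (sub_pos.2 l3)]

theorem stmt_4 (ρ θ : ℝ) (hρ : ρ ∈ Set.Ioo (0:ℝ) (1/2)) (hθ : θ ∈ Set.Ioo (0:ℝ) (1/2))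
    (h : 1 < binEnt ρ + binEnt θ) :
    ∃! δ : ℝ, δ ∈ Set.Ioo 0 ρ ∧ binEnt (bconv δ θ) - binEnt δ = 1 - binEnt ρ := by
  obtain ⟨r0, r1⟩ := hρ
  obtain ⟨t0, t1⟩ := hθ
  have hl : 0 < Real.log 2 := Real.log_pos (by norm_num)
  have key : ∀ δ, binEnt (bconv δ θ) - binEnt δ = 1 - binEnt ρ ↔
      Real.binEntropy (bconv δ θ) - Real.binEntropy δ = Real.log 2 - Real.binEntropy ρ := by
    intro δ
    simp only [binEnt_eq]
    field_simp
  have h' : Real.log 2 < Real.binEntropy ρ + Real.binEntropy θ := by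
    rw [binEnt_eq, binEnt_eq, ← add_div, lt_div_iff₀ hl] at h
    linarith
  have anti := gap_strictAnti θ t0 t1
  have hcont : ContinuousOn (fun δ => Real.binEntropy (bconv δ θ) - Real.binEntropy δ)
      (Set.Icc 0 ρ) := by
    apply Continuous.continuousOn
    unfold bconv
    fun_prop
  have hlt : Real.binEntropy (bconv ρ θ) < Real.log 2 := by
    rw [Real.binEntropy_lt_log_two]
    have : bconv ρ θ < 1/2 := by unfold bconv; nlinarith
    intro h2
    rw [h2] at this
    norm_num at this
  have h00 : bconv 0 θ = θ := by simp [bconv]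
  obtain ⟨δ, hδ, he⟩ := intermediate_value_Ioo' r0.le hcont
    (show Real.log 2 - Real.binEntropy ρ ∈ _ from
      ⟨by linarith, by simp only [h00, Real.binEntropy_zero]; linarith⟩)
  refine ⟨δ, ⟨hδ, (key δ).2 he⟩, ?_⟩
  rintro y ⟨hy, hye⟩
  have hye' := (key y).1 hye
  exact anti.injOn ⟨hy.1.le, by linarith [hy.2]⟩ ⟨hδ.1.le, by linarith [hδ.2]⟩
    (hye'.trans he.symm)
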